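/- arXiv:1812.11368 — 4 statements merged into one kernel-verified Lean document; each statement's English description precedes it below -/
import Mathlib

section
/- Let α ∈ (0,1), let a be an integer, let m be a positive integer, and let x : ℤ → ℝ. Then for every integer k ≥ a, ᶜ∇ᵃ_k^α (x^{2^m}) ≤ 2^m · x(k)^{2^m − 1} · ᶜ∇ᵃ_k^α x, where x^p denotes the function j ↦ x(j)^p. -/
noncomputable def nablaCaputo (α : ℝ) (a : ℤ) (f : ℤ → ℝ) (k : ℤ) : ℝ :=
  ∑ j ∈ Finset.Icc a k,
    Real.Gamma (((k - j : ℤ) : ℝ) + 1 - α) /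
      (Real.Gamma (1 - α) * Real.Gamma (((k - j : ℤ) : ℝ) + 1)) * (f j - f (j - 1))

/-- Abel-type bound: nonnegative monotone weights against the differences of a nonnegative
function. -/
theorem sum_Icc_mul_sub_le {a k : ℤ} (hk : a ≤ k) (w y : ℤ → ℝ)
    (hw : ∀ j, a ≤ j → j ≤ k → 0 ≤ w j) (hmono : ∀ j, a ≤ j → j < k → w j ≤ w (j + 1))
    (hy : ∀ j, 0 ≤ y j) :
    ∑ j ∈ Finset.Icc a k, w j * (y j - y (j - 1)) ≤ w k * y k := by
  induction k, hk using Int.leInduction with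
  | base =>
    have := mul_nonneg (hw a le_rfl le_rfl) (hy (a - 1))
    simp only [Finset.Icc_self, Finset.sum_singleton]
    linarith
  | succ n hn ih =>
    have hIcc : Finset.Icc a (n + 1) = insert (n + 1) (Finset.Icc a n) := by
      ext j
      simp only [Finset.mem_Icc, Finset.mem_insert]
      lia
    rw [hIcc, Finset.sum_insert (by simp), add_sub_cancel_right]
    have hsum := ih (fun j h₁ h₂ => hw j h₁ (by lia)) (fun j h₁ h₂ => hmono j h₁ (by lia))
    have hstep := mul_le_mul_of_nonneg_right (hmono n hn (by lia)) (hy n)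
    linarith

theorem nablaCaputo_weight_nonneg {α s : ℝ} (hα : α < 1) (hs : 0 ≤ s) :
    0 ≤ Real.Gamma (s + 1 - α) / (Real.Gamma (1 - α) * Real.Gamma (s + 1)) := by
  have h₁ := Real.Gamma_pos_of_pos (s := s + 1 - α) (by linarith)
  have h₂ := Real.Gamma_pos_of_pos (s := 1 - α) (by linarith)
  have h₃ := Real.Gamma_pos_of_pos (s := s + 1) (by linarith)
  positivity

theorem nablaCaputo_weight_add_one_le {α s : ℝ} (hα0 : 0 < α) (hα1 : α < 1) (hs : 0 ≤ s) :
    Real.Gamma (s + 1 + 1 - α) / (Real.Gamma (1 - α) * Real.Gamma (s + 1 + 1)) ≤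
      Real.Gamma (s + 1 - α) / (Real.Gamma (1 - α) * Real.Gamma (s + 1)) := by
  have h₁ := Real.Gamma_pos_of_pos (s := s + 1 - α) (by linarith)
  have h₂ := Real.Gamma_pos_of_pos (s := 1 - α) (by linarith)
  have h₃ := Real.Gamma_pos_of_pos (s := s + 1) (by linarith)
  rw [show s + 1 + 1 - α = s + 1 - α + 1 by ring, Real.Gamma_add_one (by linarith),
    Real.Gamma_add_one (s := s + 1) (by linarith), div_le_div_iff₀ (by positivity) (by positivity)]
  have := mul_pos (mul_pos (mul_pos h₁ h₂) h₃) hα0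
  linarith

/-- The graph of `t ↦ t ^ 2 ^ m` lies above its tangent lines. -/
theorem tangent_le_pow_two_pow {m : ℕ} (hm : 0 < m) (c t : ℝ) :
    c ^ 2 ^ m + 2 ^ m * c ^ (2 ^ m - 1) * (t - c) ≤ t ^ 2 ^ m := by
  induction m, hm using Nat.le_induction with
  | base => norm_num; nlinarith [sq_nonneg (t - c)]
  | succ n hn ih =>
    have hpos : 0 < 2 ^ n := by positivity
    have hc : 0 ≤ c ^ 2 ^ n := (even_two.pow_of_ne_zero (by lia)).pow_nonneg c
    rw [show 2 ^ (n + 1) - 1 = 2 ^ n + (2 ^ n - 1) by rw [pow_succ]; lia, pow_add c,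
      pow_succ 2 n, pow_mul c, pow_mul t, pow_succ (2 : ℝ) n]
    nlinarith [sq_nonneg (t ^ 2 ^ n - c ^ 2 ^ n), mul_le_mul_of_nonneg_left ih hc]

theorem nablaC_pow_two_pow (α : ℝ) (hα0 : 0 < α) (hα1 : α < 1) (a : ℤ)
    (m : ℕ) (hm : 0 < m) (x : ℤ → ℝ) (k : ℤ) (hk : a ≤ k) :
    nablaCaputo α a (fun j => x j ^ (2 ^ m)) k ≤
      (2 : ℝ) ^ m * x k ^ (2 ^ m - 1) * nablaCaputo α a x k := by
  have h := sum_Icc_mul_sub_le hk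
    (fun j => Real.Gamma (((k - j : ℤ) : ℝ) + 1 - α) /
      (Real.Gamma (1 - α) * Real.Gamma (((k - j : ℤ) : ℝ) + 1)))
    (fun j => x j ^ 2 ^ m - (x k ^ 2 ^ m + 2 ^ m * x k ^ (2 ^ m - 1) * (x j - x k)))
    (fun j _ hj => nablaCaputo_weight_nonneg hα1 (by exact_mod_cast sub_nonneg.2 hj))
    (fun j _ hj => by
      have hs : (0 : ℝ) ≤ ((k - (j + 1) : ℤ) : ℝ) := by
        exact_mod_cast sub_nonneg.2 (Int.add_one_le_of_lt hj)
      have hcast : ((k - j : ℤ) : ℝ) = ((k - (j + 1) : ℤ) : ℝ) + 1 := by push_cast; ring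
      simp only [hcast]
      exact nablaCaputo_weight_add_one_le hα0 hα1 hs)
    (fun j => sub_nonneg.2 (tangent_le_pow_two_pow hm (x k) (x j)))
  rw [sub_self (x k), mul_zero, add_zero, sub_self (x k ^ 2 ^ m), mul_zero] at h
  rw [← sub_nonpos]
  refine le_of_eq_of_le ?_ h
  simp only [nablaCaputo]
  rw [Finset.mul_sum, ← Finset.sum_sub_distrib]
  exact Finset.sum_congr rfl fun j _ => by ring
end

section
/- Let α ∈ (0,1), let a be an integer, let m be a positive integer, and let x : ℤ → ℝ. Then for every integer k ≥ a, ᶜ∇ᵃ_k^α (x^{2m}) ≤ 2m · x(k)^{2m−1} · ᶜ∇ᵃ_k^α x, where x^p denotes the function j ↦ x(j)^p. -/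
/-- Summation by parts with nonnegative `h` and weights that increase up to `k`. -/
theorem sum_Icc_mul_sub_le_s6 {v h : ℤ → ℝ} {k : ℤ} (hv : ∀ j < k, v j ≤ v (j + 1))
    (hh : ∀ j, 0 ≤ h j) {a : ℤ} (hak : a ≤ k) :
    ∑ j ∈ Finset.Icc a k, v j * (h j - h (j - 1)) ≤ v k * h k - v a * h (a - 1) := by
  induction a, hak using Int.leInductionDown with
  | base => simp [mul_sub]
  | pred a ha ih =>
    have hIcc : Finset.Icc (a - 1) k = insert (a - 1) (Finset.Icc a k) := by
      ext j
      simp only [Finset.mem_Icc, Finset.mem_insert]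
      lia
    rw [hIcc, Finset.sum_insert (by simp)]
    have hva := hv (a - 1) (by lia)
    rw [sub_add_cancel] at hva
    linarith [mul_le_mul_of_nonneg_right hva (hh (a - 1))]

/-- The ratio `Γ(t - α) / Γ(t)` is decreasing along unit steps. -/
theorem Gamma_sub_div_Gamma_add_one_le {α t : ℝ} (hα : 0 < α) (ht : α < t) :
    Real.Gamma (t + 1 - α) / Real.Gamma (t + 1) ≤ Real.Gamma (t - α) / Real.Gamma t := by
  have ht0 : 0 < t := hα.trans ht
  have hsub : 0 < t - α := sub_pos.2 ht
  rw [add_sub_right_comm, Real.Gamma_add_one hsub.ne', Real.Gamma_add_one ht0.ne',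
    mul_div_mul_comm]
  refine mul_le_of_le_one_left ?_ ?_
  · exact div_nonneg (Real.Gamma_pos_of_pos hsub).le (Real.Gamma_pos_of_pos ht0).le
  · rw [div_le_one ht0]
    linarith

/-- A convex function on `ℝ` lies above its tangent lines. -/
theorem ConvexOn.add_mul_sub_le_of_hasDerivAt {f : ℝ → ℝ} {f' x : ℝ}
    (hf : ConvexOn ℝ Set.univ f) (hx : HasDerivAt f f' x) (y : ℝ) :
    f x + f' * (y - x) ≤ f y := by
  rcases lt_trichotomy x y with hxy | rfl | hxy
  · have := hf.le_slope_of_hasDerivAt (Set.mem_univ _) (Set.mem_univ _) hxy hx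
    rw [slope_def_field, le_div_iff₀ (sub_pos.2 hxy)] at this
    linarith
  · simp
  · have := hf.slope_le_of_hasDerivAt (Set.mem_univ _) (Set.mem_univ _) hxy hx
    rw [slope_def_field, div_le_iff₀ (sub_pos.2 hxy)] at this
    linarith

/-- The nabla Caputo difference is nonpositive at a global minimum. -/
theorem nablaCaputo_nonpos_of_forall_le {α : ℝ} (hα0 : 0 < α) (hα1 : α < 1) {a k : ℤ}
    (hk : a ≤ k) {g : ℤ → ℝ} (hg : ∀ j, g k ≤ g j) : nablaCaputo α a g k ≤ 0 := by
  set v : ℤ → ℝ := fun j => Real.Gamma (((k - j : ℤ) : ℝ) + 1 - α) /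
    (Real.Gamma (1 - α) * Real.Gamma (((k - j : ℤ) : ℝ) + 1)) with hv
  have hα : 0 < Real.Gamma (1 - α) := Real.Gamma_pos_of_pos (sub_pos.2 hα1)
  have hmono : ∀ j < k, v j ≤ v (j + 1) := by
    intro j hj
    have hkj : (1 : ℝ) ≤ ((k - j : ℤ) : ℝ) := by exact_mod_cast (by lia : 1 ≤ k - j)
    have hcast : ((k - (j + 1) : ℤ) : ℝ) + 1 = ((k - j : ℤ) : ℝ) := by
      push_cast
      ring
    simp only [hv, hcast, div_mul_eq_div_div_swap]
    gcongr ?_ / _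
    exact Gamma_sub_div_Gamma_add_one_le hα0 (hα1.trans_le hkj)
  have hva : 0 ≤ v a := by
    have hka : (0 : ℝ) ≤ ((k - a : ℤ) : ℝ) := by exact_mod_cast sub_nonneg.2 hk
    exact div_nonneg (Real.Gamma_pos_of_pos (by linarith)).le
      (mul_pos hα (Real.Gamma_pos_of_pos (by linarith))).le
  have hsum := sum_Icc_mul_sub_le_s6 (h := fun j => g j - g k) hmono
    (fun j => sub_nonneg.2 (hg j)) hk
  simp only [sub_sub_sub_cancel_right, sub_self, mul_zero, zero_sub] at hsum
  exact hsum.trans (neg_nonpos.2 (mul_nonneg hva (sub_nonneg.2 (hg _))))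

theorem nablaCaputo_sub_const_mul (α : ℝ) (a k : ℤ) (f g : ℤ → ℝ) (c : ℝ) :
    nablaCaputo α a (fun j => f j - c * g j) k =
      nablaCaputo α a f k - c * nablaCaputo α a g k := by
  simp only [nablaCaputo, Finset.mul_sum, ← Finset.sum_sub_distrib]
  exact Finset.sum_congr rfl fun j _ => by ring

theorem nablaC_cor_two (α : ℝ) (hα0 : 0 < α) (hα1 : α < 1) (a : ℤ)
    (m : ℕ) (hm : 0 < m) (x : ℤ → ℝ) (k : ℤ) (hk : a ≤ k) :
    nablaCaputo α a (fun j => x j ^ (2 * m)) k ≤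
      (2 * m : ℝ) * x k ^ (2 * m - 1) * nablaCaputo α a x k := by
  rw [← sub_nonpos, ← nablaCaputo_sub_const_mul]
  refine nablaCaputo_nonpos_of_forall_le hα0 hα1 hk fun j => ?_
  have htangent := (even_two_mul m).convexOn_pow.add_mul_sub_le_of_hasDerivAt
    (hasDerivAt_pow (2 * m) (x k)) (x j)
  push_cast at htangent
  linarith
end

section
/- Let α ∈ (0,1), let a be an integer, let m, n be positive integers with 2m ≥ n, and let x : ℤ → ℝ. Then for every integer k ≥ a, ᴿ∇ᵃ_k^α (x^{2m}) ≤ (2m/n) · x(k)^{2m−n} · ᴿ∇ᵃ_k^α (x^n), where x^p denotes the function j ↦ x(j)^p. -/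
noncomputable def nablaRL (α : ℝ) (a : ℤ) (f : ℤ → ℝ) (k : ℤ) : ℝ :=
  (∑ j ∈ Finset.Icc a k,
    Real.Gamma (((k - j : ℤ) : ℝ) + 1 - α) /
      (Real.Gamma (1 - α) * Real.Gamma (((k - j : ℤ) : ℝ) + 1)) * f j) -
  ∑ j ∈ Finset.Icc a (k - 1),
    Real.Gamma (((k - j : ℤ) : ℝ) - α) /
      (Real.Gamma (1 - α) * Real.Gamma (((k - j : ℤ) : ℝ))) * f j

/-- The kernel `Γ(i + 1 - α) / (Γ(1 - α) Γ(i + 1))` of the nabla fractional sum. -/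
noncomputable def nablaKernel (α : ℝ) (i : ℤ) : ℝ :=
  Real.Gamma ((i : ℝ) + 1 - α) / (Real.Gamma (1 - α) * Real.Gamma ((i : ℝ) + 1))

lemma nablaKernel_zero {α : ℝ} (hα1 : α < 1) : nablaKernel α 0 = 1 := by
  have := (Real.Gamma_pos_of_pos (sub_pos.2 hα1)).ne'
  simp [nablaKernel, this]

lemma nablaKernel_pos {α : ℝ} (hα1 : α < 1) {i : ℤ} (hi : 0 ≤ i) : 0 < nablaKernel α i := by
  have hi' : (0 : ℝ) ≤ i := by exact_mod_cast hi
  have h₁ := Real.Gamma_pos_of_pos (show 0 < (i : ℝ) + 1 - α by linarith)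
  have h₂ := Real.Gamma_pos_of_pos (sub_pos.2 hα1)
  have h₃ := Real.Gamma_pos_of_pos (show 0 < (i : ℝ) + 1 by linarith)
  unfold nablaKernel
  positivity

lemma nablaKernel_le_sub_one {α : ℝ} (hα0 : 0 < α) (hα1 : α < 1) {i : ℤ} (hi : 1 ≤ i) :
    nablaKernel α i ≤ nablaKernel α (i - 1) := by
  have hi' : (1 : ℝ) ≤ i := by exact_mod_cast hi
  have hpos := nablaKernel_pos hα1 (sub_nonneg.2 hi)
  have hrec : nablaKernel α i = ((i - α) / i) * nablaKernel α (i - 1) := by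
    have h₁ : Real.Gamma ((i : ℝ) + 1 - α) = (i - α) * Real.Gamma (i - α) := by
      rw [← Real.Gamma_add_one (by linarith)]
      ring_nf
    have h₂ : Real.Gamma ((i : ℝ) + 1) = i * Real.Gamma i := Real.Gamma_add_one (by linarith)
    simp only [nablaKernel, Int.cast_sub, Int.cast_one, sub_add_cancel, h₁, h₂]
    rw [div_mul_div_comm]
    ring_nf
  rw [hrec]
  exact mul_le_of_le_one_left hpos.le ((div_le_one (by linarith)).2 (by linarith))

lemma sum_Icc_sub_eq_of_le (g : ℤ → ℝ) {a k : ℤ} (hk : a ≤ k) :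
    ∑ j ∈ Finset.Icc a (k - 1), (g (k - j - 1) - g (k - j)) = g 0 - g (k - a) := by
  induction a, hk using Int.leInductionDown with
  | base => simp
  | pred b hb ih =>
    have hins : Finset.Icc (b - 1) (k - 1) = insert (b - 1) (Finset.Icc b (k - 1)) := by
      ext j
      simp only [Finset.mem_Icc, Finset.mem_insert]
      omega
    rw [hins, Finset.sum_insert (by simp), ih, show k - (b - 1) - 1 = k - b by ring]
    ring

lemma nablaRL_eq_sub_sum {α : ℝ} (hα1 : α < 1) {a k : ℤ} (hk : a ≤ k) (f : ℤ → ℝ) :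
    nablaRL α a f k = f k - ∑ j ∈ Finset.Icc a (k - 1),
      (nablaKernel α (k - j - 1) - nablaKernel α (k - j)) * f j := by
  have hins : Finset.Icc a k = insert k (Finset.Icc a (k - 1)) := by
    ext j
    simp only [Finset.mem_Icc, Finset.mem_insert]
    omega
  have h : nablaRL α a f k = ∑ j ∈ Finset.Icc a k, nablaKernel α (k - j) * f j -
      ∑ j ∈ Finset.Icc a (k - 1), nablaKernel α (k - j - 1) * f j := by
    simp only [nablaRL, nablaKernel, Int.cast_sub, Int.cast_one, sub_add_cancel]
  rw [h, hins, Finset.sum_insert (by simp), sub_self, nablaKernel_zero hα1]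
  simp only [sub_mul, Finset.sum_sub_distrib]
  ring

/-- Weighted arithmetic-geometric mean inequality with natural number weights. -/
lemma add_mul_pow_mul_pow_le {A B : ℝ} (hA : 0 ≤ A) (hB : 0 ≤ B) (u v : ℕ) (hv : 0 < v) :
    ((u : ℝ) + v) * (A ^ u * B ^ v) ≤ u * A ^ (u + v) + v * B ^ (u + v) := by
  have huv : (0 : ℝ) < u + v := by positivity
  have hroot {C : ℝ} (hC : 0 ≤ C) (w : ℕ) : (C ^ (u + v)) ^ ((w : ℝ) / (u + v)) = C ^ w := by
    rw [← Real.rpow_natCast C (u + v), ← Real.rpow_mul hC, ← Real.rpow_natCast C w]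
    congr 1
    push_cast
    field_simp
  have h := Real.geom_mean_le_arith_mean2_weighted (w₁ := (u : ℝ) / (u + v))
    (w₂ := (v : ℝ) / (u + v)) (by positivity) (by positivity) (pow_nonneg hA (u + v))
    (pow_nonneg hB (u + v)) (by field_simp)
  rw [hroot hA, hroot hB] at h
  calc ((u : ℝ) + v) * (A ^ u * B ^ v)
      ≤ (u + v) * (u / (u + v) * A ^ (u + v) + v / (u + v) * B ^ (u + v)) := by gcongr
    _ = u * A ^ (u + v) + v * B ^ (u + v) := by field_simp

lemma div_mul_pow_mul_pow_sub_pow_le {m n : ℕ} (hn : 0 < n) (hmn : n ≤ 2 * m) (X t : ℝ) :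
    (2 * m : ℝ) / n * X ^ (2 * m - n) * t ^ n - t ^ (2 * m) ≤
      ((2 * m : ℝ) / n - 1) * X ^ (2 * m) := by
  have hn' : (0 : ℝ) < n := by exact_mod_cast hn
  have h := add_mul_pow_mul_pow_le (abs_nonneg X) (abs_nonneg t) (2 * m - n) n hn
  rw [Nat.sub_add_cancel hmn, Nat.cast_sub hmn, (even_two_mul m).pow_abs,
    (even_two_mul m).pow_abs] at h
  push_cast at h
  have habs : X ^ (2 * m - n) * t ^ n ≤ |X| ^ (2 * m - n) * |t| ^ n := by
    simpa only [abs_mul, abs_pow] using le_abs_self (X ^ (2 * m - n) * t ^ n)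
  have hmul : (2 * m : ℝ) * (X ^ (2 * m - n) * t ^ n) ≤
      (2 * m - n) * X ^ (2 * m) + n * t ^ (2 * m) := by
    rw [sub_add_cancel] at h
    exact (mul_le_mul_of_nonneg_left habs (by positivity)).trans h
  calc (2 * m : ℝ) / n * X ^ (2 * m - n) * t ^ n - t ^ (2 * m)
      = ((2 * m : ℝ) * (X ^ (2 * m - n) * t ^ n) - n * t ^ (2 * m)) / n := by field_simp
    _ ≤ ((2 * m - n) * X ^ (2 * m)) / n := by gcongr; linarith
    _ = ((2 * m : ℝ) / n - 1) * X ^ (2 * m) := by field_simp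

theorem nablaR_pow_ineq_three (α : ℝ) (hα0 : 0 < α) (hα1 : α < 1) (a : ℤ)
    (m n : ℕ) (hm : 0 < m) (hn : 0 < n) (hmn : n ≤ 2 * m) (x : ℤ → ℝ) (k : ℤ) (hk : a ≤ k) :
    nablaRL α a (fun j => x j ^ (2 * m)) k ≤
      (2 * m : ℝ) / (n : ℝ) * x k ^ (2 * m - n) * nablaRL α a (fun j => x j ^ n) k := by
  have hn' : (0 : ℝ) < n := by exact_mod_cast hn
  have hmn' : (n : ℝ) ≤ 2 * m := by exact_mod_cast hmn
  rw [nablaRL_eq_sub_sum hα1 hk, nablaRL_eq_sub_sum hα1 hk]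
  set c : ℤ → ℝ := fun j => nablaKernel α (k - j - 1) - nablaKernel α (k - j)
  set r : ℝ := (2 * m : ℝ) / n
  have hc : ∀ j ∈ Finset.Icc a (k - 1), 0 ≤ c j := fun j hj =>
    sub_nonneg.2 (nablaKernel_le_sub_one hα0 hα1 (by have := (Finset.mem_Icc.1 hj).2; omega))
  have hsum : ∑ j ∈ Finset.Icc a (k - 1), c j ≤ 1 := by
    rw [sum_Icc_sub_eq_of_le _ hk, nablaKernel_zero hα1]
    linarith [nablaKernel_pos hα1 (sub_nonneg.2 hk)]
  have hr : 0 ≤ (r - 1) * x k ^ (2 * m) :=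
    mul_nonneg (sub_nonneg.2 ((one_le_div hn').2 hmn')) ((even_two_mul m).pow_nonneg _)
  have hbound : ∑ j ∈ Finset.Icc a (k - 1),
      c j * (r * x k ^ (2 * m - n) * x j ^ n - x j ^ (2 * m)) ≤ (r - 1) * x k ^ (2 * m) := by
    calc _ ≤ ∑ j ∈ Finset.Icc a (k - 1), c j * ((r - 1) * x k ^ (2 * m)) :=
          Finset.sum_le_sum fun j hj => mul_le_mul_of_nonneg_left
            (div_mul_pow_mul_pow_sub_pow_le hn hmn (x k) (x j)) (hc j hj)
      _ ≤ _ := by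
          rw [← Finset.sum_mul]
          exact mul_le_of_le_one_left hr hsum
  have hsplit : ∑ j ∈ Finset.Icc a (k - 1),
      c j * (r * x k ^ (2 * m - n) * x j ^ n - x j ^ (2 * m)) =
      r * x k ^ (2 * m - n) * ∑ j ∈ Finset.Icc a (k - 1), c j * x j ^ n -
        ∑ j ∈ Finset.Icc a (k - 1), c j * x j ^ (2 * m) := by
    rw [Finset.mul_sum, ← Finset.sum_sub_distrib]
    exact Finset.sum_congr rfl fun j _ => by ring
  have hpow : r * x k ^ (2 * m - n) * x k ^ n = r * x k ^ (2 * m) := by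
    rw [mul_assoc, ← pow_add, Nat.sub_add_cancel hmn]
  rw [mul_sub, hpow]
  linarith
end

section
/- Let α ∈ (0,1), let a be an integer, let m, n be positive integers with 2m ≥ n, and let x : ℤ → ℝ. Then for every integer k ≥ a, ᴳ∇ᵃ_k^α (x^{2m}) ≤ (2m/n) · x(k)^{2m−n} · ᴳ∇ᵃ_k^α (x^n), where x^p denotes the function j ↦ x(j)^p. -/
noncomputable def nablaGL (α : ℝ) (a : ℤ) (f : ℤ → ℝ) (k : ℤ) : ℝ :=
  ∑ j ∈ Finset.Icc (0 : ℤ) (k - a),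
    Real.Gamma ((j : ℝ) - α) / (Real.Gamma (-α) * Real.Gamma ((j : ℝ) + 1)) * f (k - j)

/-- The Grünwald–Letnikov weight of order `α` at lag `j`. -/
noncomputable def glWeight (α : ℝ) (j : ℤ) : ℝ :=
  Real.Gamma ((j : ℝ) - α) / (Real.Gamma (-α) * Real.Gamma ((j : ℝ) + 1))

lemma Gamma_one_sub_eq {α : ℝ} (hα0 : 0 < α) :
    Real.Gamma (1 - α) = -α * Real.Gamma (-α) := by
  rw [← Real.Gamma_add_one (neg_ne_zero.mpr hα0.ne')]
  congr 1
  ring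

lemma Gamma_neg_neg {α : ℝ} (hα0 : 0 < α) (hα1 : α < 1) : Real.Gamma (-α) < 0 := by
  have h : 0 < Real.Gamma (1 - α) := Real.Gamma_pos_of_pos (by linarith)
  rw [Gamma_one_sub_eq hα0] at h
  by_contra! hge
  nlinarith

lemma glWeight_nonpos {α : ℝ} (hα0 : 0 < α) (hα1 : α < 1) {j : ℤ} (hj : 1 ≤ j) :
    glWeight α j ≤ 0 := by
  have hj' : (1 : ℝ) ≤ j := by exact_mod_cast hj
  refine div_nonpos_of_nonneg_of_nonpos (Real.Gamma_pos_of_pos (by linarith)).le ?_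
  exact mul_nonpos_of_nonpos_of_nonneg (Gamma_neg_neg hα0 hα1).le
    (Real.Gamma_pos_of_pos (by linarith)).le

lemma sum_glWeight {α : ℝ} (hα0 : 0 < α) (hα1 : α < 1) (N : ℕ) :
    ∑ j ∈ Finset.Icc (0 : ℤ) N, glWeight α j =
      Real.Gamma (N + 1 - α) / (Real.Gamma (1 - α) * Real.Gamma (N + 1)) := by
  have hα := (Gamma_neg_neg hα0 hα1).ne
  induction N with
  | zero =>
    have h : Real.Gamma (1 - α) ≠ 0 := (Real.Gamma_pos_of_pos (by linarith)).ne'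
    simp [glWeight, hα, h]
  | succ N ih =>
    have hIcc : Finset.Icc (0 : ℤ) ((N + 1 : ℕ) : ℤ) =
        insert ((N : ℤ) + 1) (Finset.Icc (0 : ℤ) N) := by
      ext i
      simp only [Finset.mem_insert, Finset.mem_Icc]
      omega
    have hN : (0 : ℝ) ≤ N := N.cast_nonneg
    have hG : Real.Gamma ((N : ℝ) + 1) ≠ 0 := (Real.Gamma_pos_of_pos (by linarith)).ne'
    have hnum : Real.Gamma ((N : ℝ) + 1 + 1 - α) =
        (N + 1 - α) * Real.Gamma ((N : ℝ) + 1 - α) := by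
      rw [← Real.Gamma_add_one (by linarith)]
      congr 1
      ring
    rw [hIcc, Finset.sum_insert (by simp), ih, glWeight]
    push_cast
    rw [hnum, Real.Gamma_add_one (s := (N : ℝ) + 1) (by linarith), Gamma_one_sub_eq hα0]
    have hN1 : (N : ℝ) + 1 ≠ 0 := by linarith
    field_simp
    ring

lemma sum_glWeight_nonneg {α : ℝ} (hα0 : 0 < α) (hα1 : α < 1) {K : ℤ} (hK : 0 ≤ K) :
    0 ≤ ∑ j ∈ Finset.Icc (0 : ℤ) K, glWeight α j := by
  lift K to ℕ using hK
  rw [sum_glWeight hα0 hα1]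
  have hK : (0 : ℝ) ≤ K := K.cast_nonneg
  have h₁ : 0 < Real.Gamma ((K : ℝ) + 1 - α) := Real.Gamma_pos_of_pos (by linarith)
  have h₂ : 0 < Real.Gamma (1 - α) := Real.Gamma_pos_of_pos (by linarith)
  have h₃ : 0 < Real.Gamma ((K : ℝ) + 1) := Real.Gamma_pos_of_pos (by linarith)
  positivity

/-- Weighted AM-GM for `u ^ M` and `y ^ M` with an even exponent `M`. -/
lemma mul_pow_sub_mul_pow_le {M n : ℕ} (hM : Even M) (hn0 : 0 < n) (hn : n ≤ M) (u y : ℝ) :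
    (M : ℝ) / n * y ^ (M - n) * u ^ n ≤ u ^ M + ((M : ℝ) / n - 1) * y ^ M := by
  have hMr : (0 : ℝ) < M := by exact_mod_cast hn0.trans_le hn
  have hnr : (0 : ℝ) < n := by exact_mod_cast hn0
  have hroot (v : ℝ) (i : ℕ) : (|v| ^ M) ^ ((i : ℝ) / M) = |v| ^ i := by
    rw [← Real.rpow_natCast |v| M, ← Real.rpow_mul (abs_nonneg v), mul_div_cancel₀ _ hMr.ne',
      Real.rpow_natCast]
  have key := Real.geom_mean_le_arith_mean2_weighted (w₁ := (n : ℝ) / M)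
    (w₂ := ((M - n : ℕ) : ℝ) / M) (by positivity) (by positivity)
    (pow_nonneg (abs_nonneg u) M) (pow_nonneg (abs_nonneg y) M)
    (by rw [Nat.cast_sub hn]; field_simp; ring)
  rw [hroot, hroot, hM.pow_abs, hM.pow_abs, Nat.cast_sub hn] at key
  have habs : y ^ (M - n) * u ^ n ≤ |u| ^ n * |y| ^ (M - n) := by
    rw [← abs_pow, ← abs_pow, ← abs_mul, mul_comm]
    exact le_abs_self _
  calc (M : ℝ) / n * y ^ (M - n) * u ^ n = (M : ℝ) / n * (y ^ (M - n) * u ^ n) := by ring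
    _ ≤ (M : ℝ) / n * ((n : ℝ) / M * u ^ M + ((M : ℝ) - n) / M * y ^ M) := by
      gcongr
      exact habs.trans key
    _ = u ^ M + ((M : ℝ) / n - 1) * y ^ M := by
      field_simp

theorem nablaG_pow_ineq_three (α : ℝ) (hα0 : 0 < α) (hα1 : α < 1) (a : ℤ)
    (m n : ℕ) (hm : 0 < m) (hn : 0 < n) (hmn : n ≤ 2 * m) (x : ℤ → ℝ) (k : ℤ) (hk : a ≤ k) :
    nablaGL α a (fun j => x j ^ (2 * m)) k ≤
      (2 * m : ℝ) / (n : ℝ) * x k ^ (2 * m - n) * nablaGL α a (fun j => x j ^ n) k := by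
  have hnr : (0 : ℝ) < n := by exact_mod_cast hn
  have hp : (0 : ℝ) ≤ (2 * m : ℝ) / n - 1 := by
    rw [sub_nonneg, one_le_div hnr]
    exact_mod_cast hmn
  have hsum := sum_glWeight_nonneg hα0 hα1 (sub_nonneg.mpr hk)
  have hterm : ∀ j ∈ Finset.Icc (0 : ℤ) (k - a),
      glWeight α j * x (k - j) ^ (2 * m) ≤
        (2 * m : ℝ) / n * x k ^ (2 * m - n) * (glWeight α j * x (k - j) ^ n) -
          glWeight α j * (((2 * m : ℝ) / n - 1) * x k ^ (2 * m)) := by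
    intro j hj
    rcases (Finset.mem_Icc.mp hj).1.eq_or_lt with rfl | hj0
    · rw [sub_zero]
      conv_lhs => rw [← Nat.sub_add_cancel hmn, pow_add]
      conv_rhs => rw [← pow_sub_mul_pow (x k) hmn]
      exact le_of_eq (by ring)
    · have h := mul_pow_sub_mul_pow_le (even_two_mul m) hn hmn (x (k - j)) (x k)
      push_cast at h
      linarith [mul_le_mul_of_nonpos_left h (glWeight_nonpos hα0 hα1 hj0)]
  have h := Finset.sum_le_sum hterm
  rw [Finset.sum_sub_distrib, ← Finset.mul_sum, ← Finset.sum_mul] at h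
  have hnonneg := mul_nonneg hsum (mul_nonneg hp ((even_two_mul m).pow_nonneg (x k)))
  exact h.trans (sub_le_self _ hnonneg)
end
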